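/- Assume λ = sup_k m_k < ∞. There exists a constant c, depending only on λ, such that for every n ∈ ℕ_+, ∫_{G_m} |K_n(x)| dμ(x) ≤ c. -/

import Mathlib

open MeasureTheory Finset

noncomputable section

namespace Vilenkin

instance (n : ℕ) : MeasurableSpace (ZMod n) := ⊤

abbrev G (m : ℕ → ℕ) : Type := ∀ k, ZMod (m k)

def M (m : ℕ → ℕ) : ℕ → ℕ
  | 0 => 1
  | k + 1 => m k * M m k

def digit (m : ℕ → ℕ) (n k : ℕ) : ℕ := (n / M m k) % m k

def rad (m : ℕ → ℕ) (k : ℕ) (x : G m) : ℂ :=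
  Complex.exp (2 * (Real.pi : ℂ) * Complex.I * ((x k).val : ℂ) / (m k : ℂ))

def psi (m : ℕ → ℕ) (n : ℕ) (x : G m) : ℂ :=
  ∏ k ∈ Finset.range (n + 1), rad m k x ^ digit m n k

def D (m : ℕ → ℕ) (n : ℕ) (x : G m) : ℂ := ∑ k ∈ Finset.range n, psi m k x

def K (m : ℕ → ℕ) (n : ℕ) (x : G m) : ℂ := (n : ℂ)⁻¹ * ∑ k ∈ Finset.range n, D m k x

def cyl (m : ℕ → ℕ) (n : ℕ) (x : G m) : Set (G m) := {y | ∀ j < n, y j = x j}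

def e (m : ℕ → ℕ) (k : ℕ) : G m := fun j => if j = k then 1 else 0

def lo (m : ℕ → ℕ) (n : ℕ) : ℕ := sInf {j | digit m n j ≠ 0}

def hi (m : ℕ → ℕ) (n : ℕ) : ℕ := sSup {j | digit m n j ≠ 0}

def Iij (m : ℕ → ℕ) (N i j : ℕ) : Set (G m) :=
  if j = N then {x | x i ≠ 0 ∧ ∀ t < N, t ≠ i → x t = 0}
  else {x | (∀ t < i, x t = 0) ∧ x i ≠ 0 ∧ (∀ t, i < t → t < j → x t = 0) ∧ x j ≠ 0}

def IsVilenkinMeasure (m : ℕ → ℕ) (μ : Measure (G m)) : Prop :=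
  IsProbabilityMeasure μ ∧ ∀ (n : ℕ) (x : G m), μ (cyl m n x) = (M m n : ENNReal)⁻¹

def fhat (m : ℕ → ℕ) (μ : Measure (G m)) (f : G m → ℂ) (k : ℕ) : ℂ :=
  ∫ x, f x * (starRingEnd ℂ) (psi m k x) ∂μ

def S (m : ℕ → ℕ) (μ : Measure (G m)) (f : G m → ℂ) (n : ℕ) (x : G m) : ℂ :=
  ∑ k ∈ Finset.range n, fhat m μ f k * psi m k x

def sigma (m : ℕ → ℕ) (μ : Measure (G m)) (f : G m → ℂ) (n : ℕ) (x : G m) : ℂ :=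
  (n : ℂ)⁻¹ * ∑ k ∈ Finset.range n, S m μ f k x

end Vilenkin

open Vilenkin

namespace Vilenkin

section Kernels

variable {m : ℕ → ℕ}

lemma M_pos (hm : ∀ k, 2 ≤ m k) (N : ℕ) : 0 < M m N := by
  induction N with
  | zero => simp [M]
  | succ N ih => exact Nat.mul_pos (by have := hm N; omega) ih

lemma two_mul_M_le (hm : ∀ k, 2 ≤ m k) (N : ℕ) : 2 * M m N ≤ M m (N + 1) :=
  Nat.mul_le_mul_right _ (hm N)

lemma M_mono (hm : ∀ k, 2 ≤ m k) : Monotone (M m) :=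
  monotone_nat_of_le_succ fun N => by have := two_mul_M_le hm N; omega

lemma lt_M (hm : ∀ k, 2 ≤ m k) (N : ℕ) : N < M m N := by
  induction N with
  | zero => simp [M]
  | succ N ih => have := two_mul_M_le hm N; omega

lemma sum_M_le (hm : ∀ k, 2 ≤ m k) (N : ℕ) : ∑ k ∈ range N, M m k ≤ M m N := by
  induction N with
  | zero => simp
  | succ N ih => rw [sum_range_succ]; have := two_mul_M_le hm N; omega

lemma M_dvd {k N : ℕ} (h : k ≤ N) : M m k ∣ M m N := by
  induction N, h using Nat.le_induction with
  | base => exact dvd_rfl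
  | succ N _ ih => exact ih.mul_left _

lemma digit_eq_zero (hm : ∀ k, 2 ≤ m k) {n L k : ℕ} (h : n < M m L) (hk : L ≤ k) :
    digit m n k = 0 := by
  rw [digit, Nat.div_eq_of_lt (h.trans_le (M_mono hm hk)), Nat.zero_mod]

lemma psi_eq_prod (hm : ∀ k, 2 ≤ m k) {n L : ℕ} (h : n < M m L) (x : G m) :
    psi m n x = ∏ k ∈ range L, rad m k x ^ digit m n k := by
  have key : ∀ {L L' : ℕ}, n < M m L → L ≤ L' →
      ∏ k ∈ range L, rad m k x ^ digit m n k = ∏ k ∈ range L', rad m k x ^ digit m n k := by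
    intro L L' h hL
    refine prod_subset (range_mono hL) fun k _ hk => ?_
    rw [digit_eq_zero hm h (by simpa using hk), pow_zero]
  have h' : n < M m (n + 1) := (Nat.lt_succ_self n).trans (lt_M hm _)
  rcases le_total L (n + 1) with hL | hL
  · exact (key h hL).symm
  · exact key h' hL

lemma digit_add_of_lt (hm : ∀ k, 2 ≤ m k) {N k : ℕ} (a j : ℕ) (hk : k < N) :
    digit m (a * M m N + j) k = digit m j k := by
  obtain ⟨q, hq⟩ := M_dvd (m := m) (Nat.succ_le_of_lt hk)
  have h : a * M m N + j = j + M m k * (m k * (q * a)) := by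
    rw [hq, Nat.succ_eq_add_one, M]; ring
  rw [digit, digit, h, Nat.add_mul_div_left _ _ (M_pos hm k), Nat.add_mul_mod_self_left]

lemma digit_add_self (hm : ∀ k, 2 ≤ m k) {N a j : ℕ} (ha : a < m N) (hj : j < M m N) :
    digit m (a * M m N + j) N = a := by
  rw [digit, add_comm, Nat.add_mul_div_right _ _ (M_pos hm N), Nat.div_eq_of_lt hj, zero_add,
    Nat.mod_eq_of_lt ha]

lemma psi_add (hm : ∀ k, 2 ≤ m k) {N a j : ℕ} (ha : a < m N) (hj : j < M m N) (x : G m) :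
    psi m (a * M m N + j) x = rad m N x ^ a * psi m j x := by
  have h : a * M m N + j < M m (N + 1) := by
    calc a * M m N + j < (a + 1) * M m N := by rw [add_mul, one_mul]; omega
      _ ≤ m N * M m N := Nat.mul_le_mul_right _ ha
  rw [psi_eq_prod hm h, psi_eq_prod hm hj, prod_range_succ, digit_add_self hm ha hj, mul_comm]
  congr 1
  exact prod_congr rfl fun k hk => by rw [digit_add_of_lt hm _ _ (mem_range.1 hk)]

lemma norm_rad (k : ℕ) (x : G m) : ‖rad m k x‖ = 1 := by
  have h : 2 * (Real.pi : ℂ) * Complex.I * ((x k).val : ℂ) / (m k : ℂ)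
      = ((2 * Real.pi * (x k).val / m k : ℝ) : ℂ) * Complex.I := by
    push_cast; ring
  rw [rad, h, Complex.norm_exp_ofReal_mul_I]

lemma sum_rad_pow (hm : ∀ k, 2 ≤ m k) (k : ℕ) (x : G m) :
    ∑ b ∈ range (m k), rad m k x ^ b = if x k = 0 then (m k : ℂ) else 0 := by
  have hk : m k ≠ 0 := by have := hm k; omega
  have : NeZero (m k) := ⟨hk⟩
  have hprim := Complex.isPrimitiveRoot_exp (m k) hk
  have hrad : rad m k x = Complex.exp (2 * Real.pi * Complex.I / m k) ^ (x k).val := by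
    rw [← Complex.exp_nat_mul, rad]; congr 1; ring
  split_ifs with h
  · simp [hrad, h]
  · have hne : rad m k x ≠ 1 := by
      rw [hrad]
      exact hprim.pow_ne_one_of_pos_of_lt (by simpa using h) (ZMod.val_lt _)
    have hone : rad m k x ^ m k = 1 := by
      rw [hrad, pow_right_comm, hprim.pow_eq_one, one_pow]
    rw [geom_sum_eq hne, hone, sub_self, zero_div]

lemma norm_sum_rad_pow_le (k a : ℕ) (x : G m) : ‖∑ b ∈ range a, rad m k x ^ b‖ ≤ a := by
  refine (norm_sum_le _ _).trans ?_
  simp [norm_rad]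

lemma D_add (hm : ∀ k, 2 ≤ m k) {N a j : ℕ} (ha : a < m N) (hj : j ≤ M m N) (x : G m) :
    D m (a * M m N + j) x = D m (a * M m N) x + rad m N x ^ a * D m j x := by
  rw [D, sum_range_add, D, D, mul_sum]
  congr 1
  exact sum_congr rfl fun i hi => psi_add hm ha ((mem_range.1 hi).trans_le hj) x

lemma D_mul (hm : ∀ k, 2 ≤ m k) {N a : ℕ} (ha : a ≤ m N) (x : G m) :
    D m (a * M m N) x = (∑ b ∈ range a, rad m N x ^ b) * D m (M m N) x := by
  induction a with
  | zero => simp [D]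
  | succ a ih =>
    rw [add_mul, one_mul, D_add hm (by omega) le_rfl, ih (by omega), sum_range_succ]; ring

lemma norm_D_mul_le (hm : ∀ k, 2 ≤ m k) {N a : ℕ} (ha : a ≤ m N) (x : G m) :
    ‖D m (a * M m N) x‖ ≤ a * ‖D m (M m N) x‖ := by
  rw [D_mul hm ha, norm_mul]
  exact mul_le_mul_of_nonneg_right (norm_sum_rad_pow_le _ _ _) (norm_nonneg _)

lemma norm_D_M (hm : ∀ k, 2 ≤ m k) (N : ℕ) (x : G m) :
    ‖D m (M m N) x‖ = (cyl m N 0).indicator (fun _ => (M m N : ℝ)) x := by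
  classical
  induction N with
  | zero => simp [D, M, psi, cyl, digit]
  | succ N ih =>
    rw [M, D_mul hm le_rfl, sum_rad_pow hm, norm_mul, ih]
    have hcyl : x ∈ cyl m (N + 1) 0 ↔ x ∈ cyl m N 0 ∧ x N = 0 := by
      simp only [cyl, Set.mem_ofPred_eq, Nat.forall_lt_succ_right, Pi.zero_apply]
    by_cases h1 : x N = 0 <;> by_cases h2 : x ∈ cyl m N 0 <;> simp [hcyl, h1, h2]

/-- The Fejér kernel without its normalizing factor. -/
def sumD (m : ℕ → ℕ) (n : ℕ) (x : G m) : ℂ := ∑ k ∈ range n, D m k x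

lemma sumD_add (hm : ∀ k, 2 ≤ m k) {N a j : ℕ} (ha : a < m N) (hj : j ≤ M m N) (x : G m) :
    sumD m (a * M m N + j) x
      = sumD m (a * M m N) x + j * D m (a * M m N) x + rad m N x ^ a * sumD m j x := by
  have h : ∑ i ∈ range j, D m (a * M m N + i) x
      = ∑ i ∈ range j, (D m (a * M m N) x + rad m N x ^ a * D m i x) :=
    sum_congr rfl fun i hi => D_add hm ha ((mem_range.1 hi).le.trans hj) x
  rw [sumD, sum_range_add, h, sum_add_distrib, ← mul_sum, sum_const, card_range, nsmul_eq_mul,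
    ← add_assoc, sumD, sumD]

lemma sumD_mul (hm : ∀ k, 2 ≤ m k) {N a : ℕ} (ha : a ≤ m N) (x : G m) :
    sumD m (a * M m N) x = (∑ b ∈ range a, rad m N x ^ b) * sumD m (M m N) x
      + M m N * ∑ b ∈ range a, D m (b * M m N) x := by
  induction a with
  | zero => simp [sumD]
  | succ a ih =>
    rw [add_mul, one_mul, sumD_add hm (by omega) le_rfl, ih (by omega), sum_range_succ,
      sum_range_succ]
    ring

lemma norm_sumD_mul_le (hm : ∀ k, 2 ≤ m k) {N a : ℕ} (ha : a ≤ m N) (x : G m) :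
    ‖sumD m (a * M m N) x‖ ≤ ‖∑ b ∈ range a, rad m N x ^ b‖ * ‖sumD m (M m N) x‖
      + a ^ 2 * M m N * ‖D m (M m N) x‖ := by
  rw [sumD_mul hm ha]
  refine (norm_add_le _ _).trans ?_
  rw [norm_mul, norm_mul, Complex.norm_natCast]
  have h : ‖∑ b ∈ range a, D m (b * M m N) x‖ ≤ a * (a * ‖D m (M m N) x‖) := by
    refine (norm_sum_le _ _).trans ((sum_le_card_nsmul _ _ (a * ‖D m (M m N) x‖) ?_).trans ?_)
    · intro b hb
      have hb := (mem_range.1 hb).le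
      refine (norm_D_mul_le hm (hb.trans ha) x).trans ?_
      gcongr
    · simp
  calc _ ≤ ‖∑ b ∈ range a, rad m N x ^ b‖ * ‖sumD m (M m N) x‖
      + M m N * (a * (a * ‖D m (M m N) x‖)) := by gcongr
    _ = _ := by ring

/-- Points whose coordinates below `N` vanish, except possibly the `k`-th one. -/
def zeroExcept (m : ℕ → ℕ) (N k : ℕ) : Set (G m) := {x | ∀ j < N, j ≠ k → x j = 0}

lemma norm_sumD_M_le (hm : ∀ k, 2 ≤ m k) {lam : ℕ} (hlam : ∀ k, m k ≤ lam) (N : ℕ) (x : G m) :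
    ‖sumD m (M m N) x‖ ≤ ∑ k ∈ range N,
      (zeroExcept m N k).indicator (fun _ => (lam ^ 2 * M m N * M m k : ℝ)) x := by
  classical
  induction N with
  | zero => simp [sumD, M, D]
  | succ N ih =>
    have hle := norm_sumD_mul_le hm (le_refl (m N)) x
    rw [M]
    refine hle.trans ?_
    rw [sum_range_succ, sum_rad_pow hm]
    refine add_le_add ?_ ?_
    · split_ifs with h
      · rw [Complex.norm_natCast]
        refine (mul_le_mul_of_nonneg_left ih (Nat.cast_nonneg _)).trans (le_of_eq ?_)
        rw [mul_sum]
        refine sum_congr rfl fun k hk => ?_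
        have : x ∈ zeroExcept m (N + 1) k ↔ x ∈ zeroExcept m N k := by
          simp only [zeroExcept, Set.mem_ofPred_eq,
            Nat.forall_lt_succ_right, h, implies_true, and_true]
        simp only [Set.indicator_apply, this]
        split_ifs
        · push_cast; ring
        · simp
      · rw [norm_zero, zero_mul]
        exact sum_nonneg fun k _ => Set.indicator_nonneg (fun _ _ => by positivity) _
    · have : x ∈ zeroExcept m (N + 1) N ↔ x ∈ cyl m N 0 := by
        simp only [zeroExcept, cyl, Set.mem_ofPred_eq, Pi.zero_apply]
        exact ⟨fun h j hj => h j (by omega) (by omega), fun h j hj hj' => h j (by omega)⟩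
      rw [norm_D_M hm]
      simp only [Set.indicator_apply, this]
      split_ifs
      · have h1 : (m N : ℝ) ^ 2 ≤ lam ^ 2 := by
          have : (m N : ℝ) ≤ lam := by exact_mod_cast hlam N
          gcongr
        have h2 : (M m N : ℝ) ≤ (m N * M m N : ℕ) := by
          exact_mod_cast Nat.le_mul_of_pos_left _ (by have := hm N; omega)
        gcongr
      · simp

lemma measurable_rad (k : ℕ) : Measurable (rad m k) :=
  (measurable_from_top (f := fun z : ZMod (m k) =>
    Complex.exp (2 * (Real.pi : ℂ) * Complex.I * (z.val : ℂ) / (m k : ℂ)))).comp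
    (measurable_pi_apply k)

lemma measurable_psi (n : ℕ) : Measurable (psi m n) :=
  Finset.measurable_fun_prod _ fun k _ => (measurable_rad k).pow_const _

lemma norm_psi (n : ℕ) (x : G m) : ‖psi m n x‖ = 1 := by
  simp [psi, norm_rad]

lemma measurableSet_coord_eq (j : ℕ) (a : ZMod (m j)) : MeasurableSet {x : G m | x j = a} :=
  have h : Measurable fun x : G m => x j := measurable_pi_apply j
  h (MeasurableSpace.measurableSet_top (s := ({a} : Set (ZMod (m j)))))

lemma measurableSet_cyl (N : ℕ) (x : G m) : MeasurableSet (cyl m N x) := by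
  simp only [cyl, Set.ofPred_forall]
  exact .iInter fun j => .iInter fun _ => measurableSet_coord_eq j _

lemma measurableSet_zeroExcept (N k : ℕ) : MeasurableSet (zeroExcept m N k) := by
  simp only [zeroExcept, Set.ofPred_forall]
  exact .iInter fun j => .iInter fun _ => .iInter fun _ => measurableSet_coord_eq j _

variable {μ : Measure (G m)}

lemma integrable_D [IsFiniteMeasure μ] (n : ℕ) : Integrable (D m n) μ :=
  integrable_finsetSum _ fun k _ => Integrable.of_bound (measurable_psi k).aestronglyMeasurable 1
    (ae_of_all _ fun x => (norm_psi k x).le)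

lemma integrable_sumD [IsFiniteMeasure μ] (n : ℕ) : Integrable (sumD m n) μ :=
  integrable_finsetSum _ fun k _ => integrable_D k

lemma measureReal_zeroExcept_le (hm : ∀ k, 2 ≤ m k) (hμ : IsVilenkinMeasure m μ) (N k : ℕ) :
    μ.real (zeroExcept m N k) ≤ m k / M m N := by
  have := hμ.1
  have : NeZero (m k) := ⟨by have := hm k; omega⟩
  have hsub : zeroExcept m N k ⊆ ⋃ a : ZMod (m k), cyl m N (Function.update 0 k a) := by
    intro x hx
    refine Set.mem_iUnion.2 ⟨x k, fun j hj => ?_⟩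
    rcases eq_or_ne j k with rfl | hjk
    · simp
    · simpa [hjk] using hx j hj hjk
  refine (measureReal_mono hsub).trans ((measureReal_iUnion_fintype_le _).trans (le_of_eq ?_))
  simp [Measure.real, hμ.2, ZMod.card, div_eq_mul_inv]

lemma integral_norm_D_M (hm : ∀ k, 2 ≤ m k) (hμ : IsVilenkinMeasure m μ) (N : ℕ) :
    ∫ x, ‖D m (M m N) x‖ ∂μ = 1 := by
  have h : (M m N : ℝ) ≠ 0 := by exact_mod_cast (M_pos hm N).ne'
  simp_rw [norm_D_M hm]
  rw [integral_indicator_const _ (measurableSet_cyl N 0), Measure.real, hμ.2]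
  simp [h]

lemma integral_norm_sumD_M_le (hm : ∀ k, 2 ≤ m k) {lam : ℕ} (hlam : ∀ k, m k ≤ lam)
    (hμ : IsVilenkinMeasure m μ) (N : ℕ) :
    ∫ x, ‖sumD m (M m N) x‖ ∂μ ≤ lam ^ 3 * M m N := by
  have := hμ.1
  have hN : (0 : ℝ) < M m N := by exact_mod_cast M_pos hm N
  have hint : ∀ k, Integrable
      ((zeroExcept m N k).indicator (fun _ => (lam ^ 2 * M m N * M m k : ℝ))) μ := fun k =>
    (integrable_const _).indicator (measurableSet_zeroExcept N k)
  refine (integral_mono (integrable_sumD _).norm (integrable_finsetSum _ fun k _ => hint k)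
    fun x => norm_sumD_M_le hm hlam N x).trans ?_
  rw [integral_finsetSum _ fun k _ => hint k]
  calc _ ≤ ∑ k ∈ range N, (lam : ℝ) ^ 3 * M m k := by
        refine sum_le_sum fun k _ => ?_
        rw [integral_indicator_const _ (measurableSet_zeroExcept N k), smul_eq_mul]
        have hk : (m k : ℝ) ≤ lam := by exact_mod_cast hlam k
        calc _ ≤ (lam / M m N : ℝ) * (lam ^ 2 * M m N * M m k) := by
              gcongr
              exact (measureReal_zeroExcept_le hm hμ N k).trans (by gcongr)
          _ = _ := by field_simp
    _ ≤ _ := by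
        rw [← mul_sum]
        gcongr
        exact_mod_cast sum_M_le hm N

lemma integral_norm_sumD_le (hm : ∀ k, 2 ≤ m k) {lam : ℕ} (hlam : ∀ k, m k ≤ lam)
    (hμ : IsVilenkinMeasure m μ) {N n : ℕ} (hn : n < M m N) :
    ∫ x, ‖sumD m n x‖ ∂μ ≤ (lam ^ 3 + lam + 1) * n := by
  have := hμ.1
  induction N generalizing n with
  | zero =>
    obtain rfl : n = 0 := by simpa [M] using hn
    simp [sumD]
  | succ N ih =>
    have hMN := M_pos hm N
    obtain ⟨a, j, ha, hj, rfl⟩ : ∃ a j, a < m N ∧ j < M m N ∧ n = a * M m N + j :=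
      ⟨n / M m N, n % M m N, (Nat.div_lt_iff_lt_mul hMN).2 hn, Nat.mod_lt _ hMN,
        (Nat.div_add_mod' n _).symm⟩
    have hpt : ∀ x, ‖sumD m (a * M m N + j) x‖ ≤ a * ‖sumD m (M m N) x‖
        + (a ^ 2 * M m N + j * a) * ‖D m (M m N) x‖ + ‖sumD m j x‖ := by
      intro x
      rw [sumD_add hm ha hj.le]
      refine norm_add₃_le.trans ?_
      rw [norm_mul, norm_mul, norm_pow, norm_rad, one_pow, one_mul, Complex.norm_natCast]
      have h1 := norm_sumD_mul_le hm ha.le x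
      have h2 := mul_le_mul_of_nonneg_right (norm_sum_rad_pow_le N a x)
        (norm_nonneg (sumD m (M m N) x))
      have h3 := mul_le_mul_of_nonneg_left (norm_D_mul_le hm ha.le x) (Nat.cast_nonneg (α := ℝ) j)
      linarith
    have hi1 := (integrable_sumD (μ := μ) (M m N)).norm.const_mul (a : ℝ)
    have hi2 := (integrable_D (μ := μ) (M m N)).norm.const_mul (a ^ 2 * M m N + j * a : ℝ)
    have hi3 := (integrable_sumD (μ := μ) j).norm
    refine (integral_mono (integrable_sumD _).norm ((hi1.add hi2).add hi3) hpt).trans ?_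
    rw [integral_add' (hi1.add hi2) hi3, integral_add' hi1 hi2, integral_const_mul,
      integral_const_mul, integral_norm_D_M hm hμ, mul_one]
    have hF := mul_le_mul_of_nonneg_left (integral_norm_sumD_M_le hm hlam hμ N)
      (Nat.cast_nonneg (α := ℝ) a)
    have hjF := ih hj
    have hal : (a : ℝ) ≤ lam := by exact_mod_cast ha.le.trans (hlam N)
    have hjM : (j : ℝ) ≤ M m N := by exact_mod_cast hj.le
    have h1 : (a : ℝ) ^ 2 * M m N ≤ lam * (a * M m N) := by
      rw [sq, mul_assoc]; gcongr
    have h2 : (j : ℝ) * a ≤ M m N * a := by gcongr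
    push_cast
    linarith

end Kernels

end Vilenkin

theorem statement12 (lam : ℕ) :
    ∃ c : ℝ, 0 < c ∧ ∀ (m : ℕ → ℕ), (∀ k, 2 ≤ m k) → (∀ k, m k ≤ lam) →
      ∀ (μ : Measure (G m)), IsVilenkinMeasure m μ →
      ∀ n : ℕ, 1 ≤ n → (∫ x, ‖K m n x‖ ∂μ) ≤ c := by
  refine ⟨lam ^ 3 + lam + 1, by positivity, fun m hm hlam μ hμ n hn => ?_⟩
  have hn0 : (0 : ℝ) < n := by exact_mod_cast hn
  have hK : ∀ x, ‖K m n x‖ = (n : ℝ)⁻¹ * ‖sumD m n x‖ := fun x => by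
    rw [K, norm_mul, norm_inv, Complex.norm_natCast, sumD]
  simp_rw [hK]
  rw [integral_const_mul, inv_mul_le_iff₀ hn0, mul_comm (n : ℝ)]
  exact integral_norm_sumD_le hm hlam hμ (lt_M hm n)
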